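/- Consider the action of (ℂˣ)⁵ on Fin 6 → ℂ given, writing z = (z₁,…,z₆) and t = (t₁,…,t₅), by t • z = (t₁z₁, t₂z₂, t₃z₃, t₄z₄, t₂t₄t₁⁻¹ z₅, t₃t₄t₁⁻¹ z₆). Let a = (a₁,…,a₆) : Fin 6 → ℂ with a i ≠ 0 for every i. Then the orbit of a equals {z : Fin 6 → ℂ | (∀ i, z i ≠ 0) ∧ a₂a₄·z₁z₅ = a₁a₅·z₂z₄ ∧ a₃a₄·z₁z₆ = a₁a₆·z₃z₄ ∧ a₃a₅·z₂z₆ = a₂a₆·z₃z₅}. (This is the description of the 8-dimensional (ℂˣ)⁵-orbits of points with all coordinates nonzero in a Plücker chart of G_{5,2}: the orbit is cut out by c₁'z₁z₅ = c₁z₂z₄, c₂'z₁z₆ = c₂z₃z₄, c₃'z₂z₆ = c₃z₃z₅ with c₁ = a₁a₅, c₁' = a₂a₄, c₂ = a₁a₆, c₂' = a₃a₄, c₃ = a₂a₆, c₃' = a₃a₅.) -/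

import Mathlib

/-- The action of the torus `(ℂˣ)⁵` on `ℂ⁶`, the chart `M₁₂` of `G_{5,2}`:
`t • z = (t₁z₁, t₂z₂, t₃z₃, t₄z₄, t₂t₄t₁⁻¹z₅, t₃t₄t₁⁻¹z₆)`. -/
noncomputable def chartAct (t : Fin 5 → ℂˣ) (z : Fin 6 → ℂ) : Fin 6 → ℂ :=
  ![(t 0 : ℂ) * z 0, (t 1 : ℂ) * z 1, (t 2 : ℂ) * z 2, (t 3 : ℂ) * z 3,
    (t 1 : ℂ) * (t 3 : ℂ) * (t 0 : ℂ)⁻¹ * z 4, (t 2 : ℂ) * (t 3 : ℂ) * (t 0 : ℂ)⁻¹ * z 5]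

/-- The `(ℂˣ)⁵`-orbit of a point `a ∈ ℂ⁶` with all coordinates nonzero (in the chart `M₁₂` of
`G_{5,2}`) is the 8-dimensional manifold cut out by the equations
`c₁' z₁ z₅ = c₁ z₂ z₄`, `c₂' z₁ z₆ = c₂ z₃ z₄`, `c₃' z₂ z₆ = c₃ z₃ z₅`, where
`c₁ = a₁a₅, c₁' = a₂a₄, c₂ = a₁a₆, c₂' = a₃a₄, c₃ = a₂a₆, c₃' = a₃a₅`, inside the set of points
with all coordinates nonzero. -/
theorem orbit_of_generic_point_in_chart (a : Fin 6 → ℂ) (ha : ∀ i, a i ≠ 0) :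
    {z : Fin 6 → ℂ | ∃ t : Fin 5 → ℂˣ, chartAct t a = z} =
      {z : Fin 6 → ℂ | (∀ i, z i ≠ 0) ∧
        a 1 * a 3 * (z 0 * z 4) = a 0 * a 4 * (z 1 * z 3) ∧
        a 2 * a 3 * (z 0 * z 5) = a 0 * a 5 * (z 2 * z 3) ∧
        a 2 * a 4 * (z 1 * z 5) = a 1 * a 5 * (z 2 * z 4)} := by
  have h0 := ha 0
  have h1 := ha 1
  have h2 := ha 2
  have h3 := ha 3
  ext z
  simp only [Set.mem_setOf_eq]
  constructor
  · rintro ⟨t, rfl⟩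
    have ht : (t 0 : ℂ) ≠ 0 := (t 0).ne_zero
    refine ⟨?_, ?_, ?_, ?_⟩
    · intro i
      fin_cases i <;> simp [chartAct, ha]
    · simp [chartAct]
      field_simp
    · simp [chartAct]
      field_simp
    · simp [chartAct]
      field_simp
  · rintro ⟨hz, e1, e2, -⟩
    have z0 := hz 0
    refine ⟨![Units.mk0 (z 0 / a 0) (div_ne_zero (hz 0) h0),
      Units.mk0 (z 1 / a 1) (div_ne_zero (hz 1) h1),
      Units.mk0 (z 2 / a 2) (div_ne_zero (hz 2) h2),
      Units.mk0 (z 3 / a 3) (div_ne_zero (hz 3) h3), 1], ?_⟩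
    ext i
    fin_cases i
    · simp [chartAct, h0]
    · simp [chartAct, h1]
    · simp [chartAct, h2]
    · simp [chartAct, h3]
    · simp [chartAct]
      field_simp
      linear_combination -e1
    · simp [chartAct]
      field_simp
      linear_combination -e2
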